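/- arXiv:1606.01193 — 2 statements merged into one kernel-verified Lean document; each statement's English description precedes it below -/
import Mathlib

section
/- Let X be a connected topological manifold without boundary of dimension at least 1, and let n ∈ ℕ. For every pair of subsets A, B ⊆ X with |A| = |B| = n, there exists a homeomorphism h : X → X such that h(A) = B. -/
open Set Filter Topology

/-- A bump translation of a normed space: moves `p` to `q`, is the identity off a ball. -/
theorem exists_bump_homeo {E : Type*} [NormedAddCommGroup E] [NormedSpace ℝ E] [CompleteSpace E]
    (p q : E) (r : ℝ) (hr : 0 < r) (hq : ‖q - p‖ < r) :
    ∃ g : E ≃ₜ E, g p = q ∧ ∀ z, z ∉ Metric.closedBall p r → g z = z := by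
  set f : E → E := fun z => z + max 0 (1 - ‖z - p‖ / r) • (q - p) with hf
  set c : NNReal := ⟨‖q - p‖ / r, by positivity⟩ with hc
  have hc1 : c < 1 := by
    rw [← NNReal.coe_lt_coe]
    change ‖q - p‖ / r < 1
    rwa [div_lt_one hr]
  have happ : ApproximatesLinearOn f ((ContinuousLinearEquiv.refl ℝ E : E ≃L[ℝ] E) : E →L[ℝ] E)
      univ c := by
    intro x _ y _
    have h1 : f x - f y - ((ContinuousLinearEquiv.refl ℝ E : E ≃L[ℝ] E) : E →L[ℝ] E) (x - y)
        = (max 0 (1 - ‖x - p‖ / r) - max 0 (1 - ‖y - p‖ / r)) • (q - p) := by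
      simp only [hf, sub_smul]
      simp
      abel
    rw [h1, norm_smul]
    have h2 : ‖max 0 (1 - ‖x - p‖ / r) - max 0 (1 - ‖y - p‖ / r)‖ ≤ ‖x - y‖ / r := by
      have h3 := abs_max_sub_max_le_abs (1 - ‖x - p‖ / r) (1 - ‖y - p‖ / r) 0
      rw [max_comm, max_comm _ (0:ℝ)] at h3
      rw [Real.norm_eq_abs]
      refine h3.trans ?_
      have h4 : (1 - ‖x - p‖ / r) - (1 - ‖y - p‖ / r) = (‖y - p‖ - ‖x - p‖) / r := by ring
      rw [h4, abs_div, abs_of_pos hr]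
      gcongr
      have := abs_norm_sub_norm_le (y - p) (x - p)
      rw [sub_sub_sub_cancel_right, norm_sub_rev y x] at this
      exact this
    have h5 : (c : ℝ) = ‖q - p‖ / r := rfl
    rw [h5]
    calc _ ≤ ‖x - y‖ / r * ‖q - p‖ := by gcongr
      _ = _ := by ring
  have hcN : Subsingleton E ∨
      c < ‖((ContinuousLinearEquiv.refl ℝ E).symm : E →L[ℝ] E)‖₊⁻¹ := by
    by_cases hE : Subsingleton E
    · exact Or.inl hE
    · right
      have : Nontrivial E := not_subsingleton_iff_nontrivial.mp hE
      have : ‖((ContinuousLinearEquiv.refl ℝ E).symm : E →L[ℝ] E)‖₊ = 1 := by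
        have : ((ContinuousLinearEquiv.refl ℝ E).symm : E →L[ℝ] E)
          = ContinuousLinearMap.id ℝ E := rfl
        rw [this]
        exact NNReal.eq (by simp)
      rw [this, inv_one]
      exact hc1
  refine ⟨happ.toHomeomorph f hcN, ?_, ?_⟩
  · change f p = q
    simp [hf]
  · intro z hz
    change f z = z
    have : 1 - ‖z - p‖ / r ≤ 0 := by
      rw [Metric.mem_closedBall, dist_eq_norm, not_le] at hz
      rw [sub_nonpos, one_le_div hr]
      exact hz.le
    simp [hf, max_eq_left this]

section extend
variable {E X : Type*} [TopologicalSpace E] [TopologicalSpace X] [T2Space X]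

open Classical in
/-- Extension of a self-map of a chart by the identity. -/
noncomputable def extFun (e : OpenPartialHomeomorph X E) (g : E → E) (z : X) : X :=
  if z ∈ e.source then e.symm (g (e z)) else z

theorem extFun_mem {e : OpenPartialHomeomorph X E} {K : Set E} (hKt : K ⊆ e.target)
    (g : E ≃ₜ E) (hg : ∀ z, z ∉ K → g z = z) {w : E} (hw : w ∈ e.target) : g w ∈ e.target := by
  by_cases h : g w ∈ K
  · exact hKt h
  · have := g.injective (hg _ h)
    rwa [this]

theorem extFun_continuous {e : OpenPartialHomeomorph X E} {K : Set E} (hK : IsCompact K)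
    (hKt : K ⊆ e.target) (g : E ≃ₜ E) (hg : ∀ z, z ∉ K → g z = z) :
    Continuous (extFun e g) := by
  have hcl : IsClosed (e.symm '' K) :=
    (hK.image_of_continuousOn (e.continuousOn_symm.mono hKt)).isClosed
  rw [continuous_iff_continuousAt]
  intro z
  by_cases hz : z ∈ e.source
  · have h1 : ContinuousAt (fun z => e.symm (g (e z))) z := by
      have ht := extFun_mem hKt g hg (e.map_source hz)
      exact ContinuousAt.comp (f := fun z => g (e z)) (e.continuousAt_symm ht)
        (g.continuous.continuousAt.comp (e.continuousAt hz))
    refine h1.congr ?_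
    filter_upwards [e.open_source.mem_nhds hz] with w hw
    simp [extFun, hw]
  · have hzK : z ∉ e.symm '' K := by
      rintro ⟨w, hw, rfl⟩
      exact hz (e.map_target (hKt hw))
    refine continuousAt_id.congr ?_
    filter_upwards [hcl.isOpen_compl.mem_nhds hzK] with w hw
    by_cases hws : w ∈ e.source
    · have : e w ∉ K := fun h => hw ⟨e w, h, e.left_inv hws⟩
      simp [extFun, hws, hg _ this]
    · simp [extFun, hws]

theorem extFun_inv {e : OpenPartialHomeomorph X E} {K : Set E}
    (hKt : K ⊆ e.target) (g g' : E ≃ₜ E) (hg : ∀ z, z ∉ K → g z = z)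
    (hgg : ∀ z, g' (g z) = z) (z : X) :
    extFun e g' (extFun e g z) = z := by
  by_cases hz : z ∈ e.source
  · have ht := extFun_mem hKt g hg (e.map_source hz)
    simp [extFun, hz, e.map_target ht, e.right_inv ht, hgg]
  · simp [extFun, hz]

theorem exists_ext {e : OpenPartialHomeomorph X E} {K : Set E} (hK : IsCompact K)
    (hKt : K ⊆ e.target) (g : E ≃ₜ E) (hg : ∀ z, z ∉ K → g z = z) :
    ∃ h : X ≃ₜ X, (∀ z ∈ e.source, h z = e.symm (g (e z))) ∧
      ∀ z, z ∉ e.symm '' K → h z = z := by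
  have hg' : ∀ z, z ∉ K → g.symm z = z := fun z hz => by
    rw [Homeomorph.symm_apply_eq, hg z hz]
  refine ⟨⟨⟨extFun e g, extFun e g.symm, extFun_inv hKt g g.symm hg (by simp),
    extFun_inv hKt g.symm g hg' (by simp)⟩, extFun_continuous hK hKt g hg,
    extFun_continuous hK hKt g.symm hg'⟩, ?_, ?_⟩
  · intro z hz
    change extFun e g z = _
    simp [extFun, hz]
  · intro w hw
    change extFun e g w = _
    by_cases hws : w ∈ e.source
    · have : e w ∉ K := fun h => hw ⟨e w, h, e.left_inv hws⟩
      simp [extFun, hws, hg _ this]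
    · simp [extFun, hws]
end extend

section main
variable {m : ℕ} {X : Type*} [TopologicalSpace X] [T2Space X]
  [ChartedSpace (EuclideanSpace ℝ (Fin m)) X]

/-- Points near `x` can be reached by homeomorphisms fixing a closed set off `x`. -/
theorem local_move (m : ℕ) {X : Type*} [TopologicalSpace X] [T2Space X]
    [ChartedSpace (EuclideanSpace ℝ (Fin m)) X] (C : Set X) (hC : IsClosed C) (x : X)
    (hx : x ∉ C) :
    ∀ᶠ y in 𝓝 x, ∃ h : X ≃ₜ X, h x = y ∧ ∀ c ∈ C, h c = c := by
  set e := chartAt (EuclideanSpace ℝ (Fin m)) x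
  have hxs : x ∈ e.source := mem_chart_source _ x
  have hU : e.target ∩ e.symm ⁻¹' Cᶜ ∈ 𝓝 (e x) := by
    refine (e.isOpen_inter_preimage_symm hC.isOpen_compl).mem_nhds ⟨e.map_source hxs, ?_⟩
    simpa [e.left_inv hxs] using hx
  obtain ⟨r, hr, hball⟩ := Metric.nhds_basis_closedBall.mem_iff.mp hU
  have h1 : ∀ᶠ y in 𝓝 x, e y ∈ Metric.ball (e x) r :=
    (e.continuousAt hxs).eventually (Metric.ball_mem_nhds _ hr)
  filter_upwards [h1, e.open_source.mem_nhds hxs] with y hy hys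
  obtain ⟨g, hgp, hg⟩ := exists_bump_homeo (e x) (e y) r hr
    (by rwa [Metric.mem_ball, dist_eq_norm] at hy)
  obtain ⟨h, hh1, hh2⟩ := exists_ext (isCompact_closedBall (e x) r)
    (fun z hz => (hball hz).1) g hg
  refine ⟨h, ?_, fun c hc => hh2 c ?_⟩
  · rw [hh1 x hxs, hgp, e.left_inv hys]
  · rintro ⟨w, hw, rfl⟩
    exact (hball hw).2 hc

theorem move (m : ℕ) {X : Type*} [TopologicalSpace X] [T2Space X]
    [ChartedSpace (EuclideanSpace ℝ (Fin m)) X] (C : Set X) (hC : IsClosed C) (K : Set X)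
    (hK : IsPreconnected K) (hKC : Disjoint K C) (x y : X) (hx : x ∈ K) (hy : y ∈ K) :
    ∃ h : X ≃ₜ X, h x = y ∧ ∀ c ∈ C, h c = c := by
  refine hK.induction₂ (fun x y => ∃ h : X ≃ₜ X, h x = y ∧ ∀ c ∈ C, h c = c) ?_ ?_ ?_ hx hy
  · intro x hx
    exact nhdsWithin_le_nhds (local_move m C hC x (disjoint_left.mp hKC hx))
  · rintro x y z _ _ _ ⟨h, h1, h2⟩ ⟨k, k1, k2⟩
    exact ⟨h.trans k, by simp [h1, k1], fun c hc => by simp [h2 c hc, k2 c hc]⟩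
  · rintro x y _ _ ⟨h, h1, h2⟩
    exact ⟨h.symm, by simp [← h1], fun c hc => by rw [Homeomorph.symm_apply_eq, h2 c hc]⟩

theorem image_insert_of_move {X : Type*} [TopologicalSpace X] {C : Set X} {h : X ≃ₜ X} {x y : X}
    (h1 : h x = y) (h2 : ∀ c ∈ C, h c = c) : h '' (insert x C) = insert y C := by
  rw [image_insert_eq, h1]
  congr 1
  ext z
  constructor
  · rintro ⟨c, hc, rfl⟩
    rwa [h2 c hc]
  · exact fun hz => ⟨z, hz, h2 z hz⟩

theorem local_exchange (m : ℕ) {X : Type*} [TopologicalSpace X] [T2Space X]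
    [ChartedSpace (EuclideanSpace ℝ (Fin m)) X] (C : Set X) (hC : C.Finite) (z : X) :
    ∃ V ∈ 𝓝 z, ∀ x ∈ V, ∀ y ∈ V, x ∉ C → y ∉ C →
      ∃ h : X ≃ₜ X, h '' (insert x C) = insert y C := by
  set e := chartAt (EuclideanSpace ℝ (Fin m)) z
  have hzs : z ∈ e.source := mem_chart_source _ z
  set D := C \ {z}
  have hD : D.Finite := hC.subset sdiff_subset
  have hzD : z ∉ D := fun h => h.2 rfl
  have hU : e.target ∩ e.symm ⁻¹' Dᶜ ∈ 𝓝 (e z) := by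
    refine (e.isOpen_inter_preimage_symm hD.isClosed.isOpen_compl).mem_nhds
      ⟨e.map_source hzs, ?_⟩
    simpa [e.left_inv hzs] using hzD
  obtain ⟨r, hr, hball⟩ := Metric.nhds_basis_ball.mem_iff.mp hU
  have h1 : ∀ᶠ y in 𝓝 z, e y ∈ Metric.ball (e z) r :=
    (e.continuousAt hzs).eventually (Metric.ball_mem_nhds _ hr)
  refine ⟨_, inter_mem h1 (e.open_source.mem_nhds hzs), ?_⟩
  rintro x ⟨hx, hxs⟩ y ⟨hy, hys⟩ hxC hyC
  change e x ∈ Metric.ball (e z) r at hx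
  change e y ∈ Metric.ball (e z) r at hy
  have hz : e z ∈ Metric.ball (e z) r := Metric.mem_ball_self hr
  -- moving along a segment
  have seg : ∀ F : Set X, F.Finite → ∀ u v : X, u ∈ e.source → v ∈ e.source →
      e u ∈ Metric.ball (e z) r → e v ∈ Metric.ball (e z) r →
      (∀ w ∈ F, w ∈ D ∨ (w ∈ e.source ∧ e w ∉ segment ℝ (e u) (e v))) →
      ∃ h : X ≃ₜ X, h '' (insert u F) = insert v F := by
    intro F hF u v hus hvs hu hv hw
    have hsub : segment ℝ (e u) (e v) ⊆ Metric.ball (e z) r :=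
      (convex_ball _ _).segment_subset hu hv
    obtain ⟨h, h1, h2⟩ := move m F hF.isClosed (e.symm '' segment ℝ (e u) (e v))
      ((convex_segment _ _).isPreconnected.image _
        (e.continuousOn_symm.mono fun w hw => (hball (hsub hw)).1)) (by
        rw [disjoint_left]
        rintro _ ⟨p, hp, rfl⟩ hpF
        rcases hw _ hpF with h | ⟨_, h⟩
        · exact (hball (hsub hp)).2 h
        · rw [e.right_inv (hball (hsub hp)).1] at h
          exact h hp) u v
      ⟨e u, left_mem_segment _ _ _, e.left_inv hus⟩ ⟨e v, right_mem_segment _ _ _, e.left_inv hvs⟩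
    exact ⟨h, image_insert_of_move h1 h2⟩
  by_cases hzC : z ∈ C
  swap
  · refine seg C hC x y hxs hys hx hy fun w hw => Or.inl ⟨hw, ?_⟩
    rintro rfl
    exact hzC hw
  have hCD : C = insert z D := by simp [D, insert_eq_of_mem hzC]
  by_cases hzseg : e z ∈ segment ℝ (e x) (e y)
  swap
  · refine seg C hC x y hxs hys hx hy fun w hw => ?_
    by_cases hwz : w = z
    · subst hwz
      exact Or.inr ⟨hzs, hzseg⟩
    · exact Or.inl ⟨hw, hwz⟩
  have hxz : e x ≠ e z := fun h => hxC (by rwa [e.injOn hxs hzs h])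
  have hyz : e y ≠ e z := fun h => hyC (by rwa [e.injOn hys hzs h])
  have hw : Wbtw ℝ (e x) (e z) (e y) := mem_segment_iff_wbtw.mp hzseg
  obtain ⟨h, hh⟩ := seg (insert x D) (hD.insert x) z y hzs hys hz hy (by
    rintro w (rfl | hwD)
    · refine Or.inr ⟨hxs, fun hs => hxz ?_⟩
      exact (hw.swap_left_iff.mp (mem_segment_iff_wbtw.mp hs))
    · exact Or.inl hwD)
  obtain ⟨k, hk⟩ := seg (insert y D) (hD.insert y) x z hxs hzs hx hz (by
    rintro w (rfl | hwD)
    · refine Or.inr ⟨hys, fun hs => hyz ?_⟩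
      exact (hw.swap_right_iff.mp (mem_segment_iff_wbtw.mp hs)).symm
    · exact Or.inl hwD)
  refine ⟨h.trans k, ?_⟩
  have : (h.trans k : X → X) = k ∘ h := rfl
  rw [this, image_comp, hCD, insert_comm, hh, insert_comm, hk, insert_comm]

theorem nhds_not_finite (m : ℕ) (hm : 1 ≤ m) {X : Type*} [TopologicalSpace X] [T2Space X]
    [ChartedSpace (EuclideanSpace ℝ (Fin m)) X] (x : X) (V : Set X) (hV : V ∈ 𝓝 x) :
    V.Infinite := by
  have : Nonempty (Fin m) := ⟨⟨0, hm⟩⟩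
  have : Nontrivial (EuclideanSpace ℝ (Fin m)) := inferInstance
  have : (𝓝[≠] x).NeBot := by
    rw [neBot_iff]
    intro h
    have ho : IsOpen {x} := isOpen_singleton_iff_punctured_nhds x |>.mpr h
    set e := chartAt (EuclideanSpace ℝ (Fin m)) x
    have ho2 := e.isOpen_image_of_subset_source ho (by simp [e])
    rw [image_singleton] at ho2
    have : (𝓝[≠] (e x)).NeBot := Module.punctured_nhds_neBot ℝ _ _
    exact not_isOpen_singleton _ ho2
  exact infinite_of_mem_nhds x hV

theorem exchange (m : ℕ) (hm : 1 ≤ m) {X : Type*} [TopologicalSpace X] [T2Space X]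
    [ChartedSpace (EuclideanSpace ℝ (Fin m)) X] [ConnectedSpace X] (C : Set X) (hC : C.Finite)
    (a b : X) (ha : a ∉ C) (hb : b ∉ C) :
    ∃ h : X ≃ₜ X, h '' (insert a C) = insert b C := by
  set U : Set X := {z | ∀ᶠ x in 𝓝 z, x ∉ C → ∃ h : X ≃ₜ X, h '' (insert a C) = insert x C}
    with hUdef
  -- one good point in a nice neighbourhood suffices
  have key : ∀ z : X, ∃ V ∈ 𝓝 z, (∃ w ∈ V, w ∉ C ∧
      ∃ h : X ≃ₜ X, h '' (insert a C) = insert w C) → z ∈ U := by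
    intro z
    obtain ⟨V, hV, hVe⟩ := local_exchange m C hC z
    refine ⟨V, hV, ?_⟩
    rintro ⟨w, hw, hwC, h, hh⟩
    change ∀ᶠ x in 𝓝 z, _
    filter_upwards [hV] with x hx hxC
    obtain ⟨k, hk⟩ := hVe w hw x hx hwC hxC
    refine ⟨h.trans k, ?_⟩
    have : (h.trans k : X → X) = k ∘ h := rfl
    rw [this, image_comp, hh, hk]
  have haU : a ∈ U := by
    obtain ⟨V, hV, hVU⟩ := key a
    exact hVU ⟨a, mem_of_mem_nhds hV, ha, Homeomorph.refl X, by simp⟩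
  have hopen : IsOpen U := by
    rw [isOpen_iff_mem_nhds]
    intro z hz
    exact eventually_eventually_nhds.mpr hz
  have hclosed : IsClosed U := by
    rw [← closure_subset_iff_isClosed]
    intro z hz
    obtain ⟨V, hV, hVU⟩ := key z
    obtain ⟨x, hxV, hxU⟩ := mem_closure_iff_nhds.mp hz _ (interior_mem_nhds.mpr hV)
    have hn := inter_mem (isOpen_interior.mem_nhds hxV) hxU
    obtain ⟨w, hw, hwC⟩ := ((nhds_not_finite m hm x _ hn).sdiff hC).nonempty
    exact hVU ⟨w, interior_subset hw.1, hwC, hw.2 hwC⟩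
  have huniv : U = univ := IsClopen.eq_univ ⟨hclosed, hopen⟩ ⟨a, haU⟩
  have hbU : b ∈ U := huniv ▸ mem_univ b
  exact Eventually.self_of_nhds hbU hb

end main

theorem stmt3 (m n : ℕ) (hm : 1 ≤ m) (X : Type*) [TopologicalSpace X] [T2Space X]
    [ChartedSpace (EuclideanSpace ℝ (Fin m)) X] [CompactSpace X] [ConnectedSpace X]
    (A B : Set X) (hA : A.Finite) (hB : B.Finite) (hAn : A.ncard = n) (hBn : B.ncard = n) :
    ∃ h : X ≃ₜ X, h '' A = B := by
  induction n generalizing A B with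
  | zero =>
    rw [ncard_eq_zero hA] at hAn
    rw [ncard_eq_zero hB] at hBn
    subst hAn hBn
    exact ⟨Homeomorph.refl X, by simp⟩
  | succ n ih =>
    obtain ⟨a, A', ha, rfl, hA'⟩ := eq_insert_of_ncard_eq_succ hAn
    obtain ⟨b, B', hb, rfl, hB'⟩ := eq_insert_of_ncard_eq_succ hBn
    have hB'f : B'.Finite := hB.subset (subset_insert _ _)
    obtain ⟨h, hh⟩ := ih A' B' (hA.subset (subset_insert _ _)) hB'f hA' hB'
    have hha : h a ∉ B' := by
      rw [← hh]
      rintro ⟨c, hc, hca⟩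
      exact ha (h.injective hca ▸ hc)
    obtain ⟨k, hk⟩ := exchange m hm B' hB'f (h a) b hha hb
    refine ⟨h.trans k, ?_⟩
    have : (h.trans k : X → X) = k ∘ h := rfl
    rw [this, image_comp, image_insert_eq, hh, hk]
end

section
/- Let X be a connected compact manifold without boundary and n ≥ 2. Then the number of orbits of the action of the homeomorphism group of Fₙ(X) on Fₙ(X) is at most n. -/
open TopologicalSpace

/-- The `n`-th symmetric product `Fₙ(X)`: nonempty subsets of `X` with at most `n` points,
topologized as a subspace of the hyperspace of nonempty compact sets with the Hausdorff
metric (which induces the Vietoris topology). -/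
def SymmProd (X : Type*) [MetricSpace X] (n : ℕ) : Type _ :=
  {A : NonemptyCompacts X // (A : Set X).Finite ∧ (A : Set X).ncard ≤ n}

noncomputable instance {X : Type*} [MetricSpace X] {n : ℕ} : MetricSpace (SymmProd X n) := by
  unfold SymmProd; infer_instance

def SymmProd.toSet {X : Type*} [MetricSpace X] {n : ℕ} (A : SymmProd X n) : Set X := A.1

/-- Extending a compactly supported homeomorphism of the model through a chart. -/
theorem aux_extend_cont {X E : Type*} [TopologicalSpace X] [T2Space X] [TopologicalSpace E]
    (e : OpenPartialHomeomorph X E) (h : E → E) (hc : Continuous h) (K : Set E) (hK : IsCompact K)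
    (hKt : K ⊆ e.target) (hid : ∀ x, x ∉ K → h x = x) (hmem : ∀ x ∈ K, h x ∈ K)
    (g : X → X) (hg1 : ∀ x ∈ e.source, g x = e.symm (h (e x))) (hg2 : ∀ x, x ∉ e.source → g x = x) :
    Continuous g := by
  have hmaps : ∀ y ∈ e.target, h y ∈ e.target := by
    intro y hy
    by_cases hyK : y ∈ K
    · exact hKt (hmem y hyK)
    · rw [hid y hyK]; exact hy
  have hKc : IsCompact (e.symm '' K) := hK.image_of_continuousOn (e.continuousOn_symm.mono hKt)
  rw [continuous_iff_continuousAt]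
  intro x
  by_cases hx : x ∈ e.source
  · have : ContinuousOn g e.source := by
      have h1 : ContinuousOn (fun x => e.symm (h (e x))) e.source :=
        e.continuousOn_symm.comp (hc.comp_continuousOn e.continuousOn)
          (fun y hy => hmaps _ (e.map_source hy))
      exact h1.congr hg1
    exact this.continuousAt (e.open_source.mem_nhds hx)
  · have hx' : x ∈ (e.symm '' K)ᶜ := by
      rintro ⟨y, hy, rfl⟩
      exact hx (e.map_target (hKt hy))
    have : g =ᶠ[nhds x] id := by
      filter_upwards [hKc.isClosed.isOpen_compl.mem_nhds hx'] with y hy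
      by_cases hys : y ∈ e.source
      · have : e y ∉ K := fun hk => hy ⟨e y, hk, e.left_inv hys⟩
        rw [hg1 y hys, hid _ this, e.left_inv hys]; rfl
      · exact hg2 y hys
    exact continuousAt_id.congr this.symm

theorem aux_extend {X E : Type*} [TopologicalSpace X] [T2Space X] [TopologicalSpace E]
    (e : OpenPartialHomeomorph X E) (h : E ≃ₜ E) (K : Set E) (hK : IsCompact K)
    (hKt : K ⊆ e.target) (hid : ∀ x, x ∉ K → h x = x) :
    ∃ H : X ≃ₜ X, (∀ x ∈ e.source, H x = e.symm (h (e x))) ∧ (∀ x, x ∉ e.source → H x = x) := by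
  classical
  have hmem : ∀ x ∈ K, h x ∈ K := by
    intro x hx
    by_contra hn
    have := h.injective (hid _ hn)
    rw [this] at hn; exact hn hx
  have hid' : ∀ x, x ∉ K → h.symm x = x := by
    intro x hx
    rw [h.symm_apply_eq, hid x hx]
  have hmem' : ∀ x ∈ K, h.symm x ∈ K := by
    intro x hx
    by_contra hn
    have := hid _ hn
    rw [h.apply_symm_apply] at this
    rw [← this] at hn; exact hn hx
  have hmaps : ∀ y ∈ e.target, h y ∈ e.target := by
    intro y hy
    by_cases hyK : y ∈ K
    · exact hKt (hmem y hyK)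
    · rw [hid y hyK]; exact hy
  have hmaps' : ∀ y ∈ e.target, h.symm y ∈ e.target := by
    intro y hy
    by_cases hyK : y ∈ K
    · exact hKt (hmem' y hyK)
    · rw [hid' y hyK]; exact hy
  let g : X → X := fun x => if x ∈ e.source then e.symm (h (e x)) else x
  let g' : X → X := fun x => if x ∈ e.source then e.symm (h.symm (e x)) else x
  have hg1 : ∀ x ∈ e.source, g x = e.symm (h (e x)) := fun x hx => if_pos hx
  have hg2 : ∀ x, x ∉ e.source → g x = x := fun x hx => if_neg hx
  have hg1' : ∀ x ∈ e.source, g' x = e.symm (h.symm (e x)) := fun x hx => if_pos hx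
  have hg2' : ∀ x, x ∉ e.source → g' x = x := fun x hx => if_neg hx
  refine ⟨{ toFun := g, invFun := g', left_inv := ?_, right_inv := ?_,
            continuous_toFun := ?_, continuous_invFun := ?_ }, hg1, hg2⟩
  · intro x
    by_cases hx : x ∈ e.source
    · have h1 := hmaps _ (e.map_source hx)
      rw [hg1 x hx, hg1' _ (e.map_target h1), e.right_inv h1, h.symm_apply_apply, e.left_inv hx]
    · rw [hg2 x hx, hg2' x hx]
  · intro x
    by_cases hx : x ∈ e.source
    · have h1 := hmaps' _ (e.map_source hx)
      rw [hg1' x hx, hg1 _ (e.map_target h1), e.right_inv h1, h.apply_symm_apply, e.left_inv hx]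
    · rw [hg2' x hx, hg2 x hx]
  · exact aux_extend_cont e h h.continuous K hK hKt hid hmem g hg1 hg2
  · have hfin := aux_extend_cont e h.symm h.symm.continuous K hK hKt hid' hmem' g' hg1' hg2'
    exact hfin

/-- Pushing the centre of a ball. -/
theorem aux_push {E : Type*} [NormedAddCommGroup E] [NormedSpace ℝ E] [CompleteSpace E]
    (p q : E) (r : ℝ) (hr : 0 < r) (hq : ‖q - p‖ < r) :
    ∃ h : E ≃ₜ E, h p = q ∧ ∀ x, x ∉ Metric.closedBall p r → h x = x := by
  let φ : E → ℝ := fun x => max 0 (1 - ‖x - p‖ / r)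
  let f : E → E := fun x => x + φ x • (q - p)
  have hφ : ∀ x y, |φ x - φ y| ≤ ‖x - y‖ / r := by
    intro x y
    have h1 : |φ x - φ y| ≤ |(1 - ‖x - p‖ / r) - (1 - ‖y - p‖ / r)| := by
      have := abs_max_sub_max_le_abs (1 - ‖x - p‖ / r) (1 - ‖y - p‖ / r) 0
      simpa [φ, max_comm] using this
    have h2 : (1 - ‖x - p‖ / r) - (1 - ‖y - p‖ / r) = (‖y - p‖ - ‖x - p‖) / r := by ring
    rw [h2, abs_div, abs_of_pos hr] at h1
    refine h1.trans ?_
    gcongr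
    have := abs_norm_sub_norm_le (y - p) (x - p)
    rwa [sub_sub_sub_cancel_right, norm_sub_rev y x] at this
  let c : NNReal := ⟨‖q - p‖ / r, by positivity⟩
  have hc : c < 1 := by
    rw [← NNReal.coe_lt_coe]
    change ‖q - p‖ / r < 1
    rwa [div_lt_one hr]
  have hf : ApproximatesLinearOn f ((ContinuousLinearEquiv.refl ℝ E : E ≃L[ℝ] E) : E →L[ℝ] E)
      Set.univ c := by
    rw [ApproximatesLinearOn.approximatesLinearOn_iff_lipschitzOnWith]
    apply LipschitzOnWith.of_dist_le_mul
    intro x _ y _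
    rw [dist_eq_norm, dist_eq_norm]
    have : (f - ⇑((ContinuousLinearEquiv.refl ℝ E : E ≃L[ℝ] E) : E →L[ℝ] E)) x -
      (f - ⇑((ContinuousLinearEquiv.refl ℝ E : E ≃L[ℝ] E) : E →L[ℝ] E)) y
        = (φ x - φ y) • (q - p) := by
      simp [f, sub_smul]
    rw [this, norm_smul, Real.norm_eq_abs]
    calc |φ x - φ y| * ‖q - p‖ ≤ ‖x - y‖ / r * ‖q - p‖ := by gcongr; exact hφ x y
      _ = ‖q - p‖ / r * ‖x - y‖ := by ring
  have hN : Subsingleton E ∨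
      c < ‖((ContinuousLinearEquiv.refl ℝ E : E ≃L[ℝ] E).symm : E →L[ℝ] E)‖₊⁻¹ := by
    rcases subsingleton_or_nontrivial E with h | h
    · exact Or.inl h
    · right
      have : ‖((ContinuousLinearEquiv.refl ℝ E : E ≃L[ℝ] E).symm : E →L[ℝ] E)‖₊ = 1 := by
        ext
        simp
      rw [this, inv_one]; exact hc
  refine ⟨hf.toHomeomorph f hN, ?_, ?_⟩
  · change f p = q
    simp [f, φ]
  · intro x hx
    change f x = x
    have h1 : r < ‖x - p‖ := by simpa [Metric.mem_closedBall, dist_eq_norm] using hx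
    have h2 : φ x = 0 := by
      apply max_eq_left
      have := (one_lt_div hr).2 h1
      linarith
    simp [f, h2]

/-- Local homogeneity of a manifold. -/
theorem aux_local {E X : Type*} [NormedAddCommGroup E] [NormedSpace ℝ E] [FiniteDimensional ℝ E]
    [TopologicalSpace X] [T2Space X] [ChartedSpace E X] (x : X) (U : Set X) (hU : U ∈ nhds x) :
    ∀ᶠ y in nhds x, ∃ h : X ≃ₜ X, h x = y ∧ ∀ z, z ∉ U → h z = z := by
  have : CompleteSpace E := FiniteDimensional.complete ℝ E
  have : ProperSpace E := FiniteDimensional.proper ℝ E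
  let e := chartAt E x
  have hxs : x ∈ e.source := mem_chart_source E x
  have hV : e.target ∩ e.symm ⁻¹' U ∈ nhds (e x) := by
    refine Filter.inter_mem (e.open_target.mem_nhds (e.map_source hxs)) ?_
    apply (e.continuousAt_symm (e.map_source hxs)).preimage_mem_nhds
    rwa [e.left_inv hxs]
  obtain ⟨r, hr, hrV⟩ := Metric.nhds_basis_closedBall.mem_iff.1 hV
  have hb : e ⁻¹' (Metric.ball (e x) r) ∈ nhds x :=
    (e.continuousAt hxs).preimage_mem_nhds (Metric.ball_mem_nhds _ hr)
  filter_upwards [hb, e.open_source.mem_nhds hxs] with y hy hys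
  obtain ⟨h, h1, h2⟩ := aux_push (e x) (e y) r hr (by simpa [dist_eq_norm] using hy)
  obtain ⟨H, H1, H2⟩ := aux_extend e h (Metric.closedBall (e x) r)
    (isCompact_closedBall _ _) (fun z hz => (hrV hz).1) h2
  refine ⟨H, by rw [H1 x hxs, h1, e.left_inv hys], ?_⟩
  intro z hz
  by_cases hzs : z ∈ e.source
  · have : e z ∉ Metric.closedBall (e x) r := by
      intro hk
      have := (hrV hk).2
      rw [Set.mem_preimage, e.left_inv hzs] at this
      exact hz this
    rw [H1 z hzs, h2 _ this, e.left_inv hzs]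
  · exact H2 z hzs

/-- Ambient equivalence of subsets. -/
def AmbEq {X : Type*} [TopologicalSpace X] (A B : Set X) : Prop := ∃ h : X ≃ₜ X, h '' A = B

theorem AmbEq.rfl' {X : Type*} [TopologicalSpace X] (A : Set X) : AmbEq A A :=
  ⟨Homeomorph.refl X, by simp⟩

theorem AmbEq.symm' {X : Type*} [TopologicalSpace X] {A B : Set X} (h : AmbEq A B) : AmbEq B A := by
  obtain ⟨h, rfl⟩ := h
  exact ⟨h.symm, by simp [Set.image_image]⟩

theorem AmbEq.trans' {X : Type*} [TopologicalSpace X] {A B C : Set X} (h : AmbEq A B)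
    (h' : AmbEq B C) : AmbEq A C := by
  obtain ⟨h, rfl⟩ := h
  obtain ⟨k, rfl⟩ := h'
  exact ⟨h.trans k, by rw [Set.image_image]; rfl⟩

theorem aux_near {E X : Type*} [NormedAddCommGroup E] [NormedSpace ℝ E] [FiniteDimensional ℝ E]
    [TopologicalSpace X] [T2Space X] [ChartedSpace E X]
    (A : Set X) (hA : A.Finite) (x : X) (hx : x ∉ A) :
    ∀ᶠ y in nhds x, AmbEq (insert x A) (insert y A) := by
  have := @aux_local E X _ _ _ _ _ _ x Aᶜ (hA.isClosed.isOpen_compl.mem_nhds hx)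
  filter_upwards [this] with y hy
  obtain ⟨h, h1, h2⟩ := hy
  refine ⟨h, ?_⟩
  rw [Set.image_insert_eq, h1]
  congr 1
  have : Set.EqOn h id A := fun z hz => h2 z (by simpa using hz)
  rw [this.image_eq, Set.image_id]

theorem aux_conn {E X : Type*} [NormedAddCommGroup E] [NormedSpace ℝ E] [FiniteDimensional ℝ E]
    [TopologicalSpace X] [T2Space X] [ChartedSpace E X]
    (A : Set X) (hA : A.Finite) (C : Set X) (hC : IsPreconnected C)
    (hCA : ∀ z ∈ C, z ∉ A) (x y : X) (hx : x ∈ C) (hy : y ∈ C) :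
    AmbEq (insert x A) (insert y A) := by
  have hopen : ∀ (P : Set X → Prop),
      (∀ B B', AmbEq B B' → P B → P B') → IsOpen {z | z ∉ A ∧ P (insert z A)} := by
    intro P hP
    rw [isOpen_iff_mem_nhds]
    rintro z ⟨hz, hz'⟩
    filter_upwards [aux_near (E := E) A hA z hz, hA.isClosed.isOpen_compl.mem_nhds hz] with w h1 h2
    exact ⟨h2, hP _ _ h1 hz'⟩
  by_contra hn
  have h1 := hopen (fun B => AmbEq (insert x A) B) (fun B B' h h' => h'.trans' h)
  have h2 := hopen (fun B => ¬ AmbEq (insert x A) B) (fun B B' h h' h'' => h' (h''.trans' h.symm'))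
  obtain ⟨z, -, hz1, hz2⟩ := hC _ _ h1 h2
    (fun z hz => by
      by_cases h : AmbEq (insert x A) (insert z A)
      · exact Or.inl ⟨hCA z hz, h⟩
      · exact Or.inr ⟨hCA z hz, h⟩)
    ⟨x, hx, hCA x hx, AmbEq.rfl' _⟩ ⟨y, hy, hCA y hy, hn⟩
  exact hz2.2 hz1.2

theorem aux_seg {E X : Type*} [NormedAddCommGroup E] [NormedSpace ℝ E] [FiniteDimensional ℝ E]
    [TopologicalSpace X] [T2Space X] [ChartedSpace E X]
    (A : Set X) (hA : A.Finite) (e : OpenPartialHomeomorph X E) (x y : X)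
    (hx : x ∈ e.source) (hy : y ∈ e.source) (hs : segment ℝ (e x) (e y) ⊆ e.target)
    (hsA : ∀ z ∈ segment ℝ (e x) (e y), e.symm z ∉ A) :
    AmbEq (insert x A) (insert y A) := by
  refine aux_conn (E := E) A hA (e.symm '' segment ℝ (e x) (e y)) ?_ ?_ x y ?_ ?_
  · exact (convex_segment _ _).isPreconnected.image _ (e.continuousOn_symm.mono hs)
  · rintro _ ⟨z, hz, rfl⟩
    exact hsA z hz
  · exact ⟨e x, left_mem_segment _ _ _, e.left_inv hx⟩
  · exact ⟨e y, right_mem_segment _ _ _, e.left_inv hy⟩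

/-- Near any point `a`, all choices of an extra point are equivalent. -/
theorem aux_nbhd {E X : Type*} [NormedAddCommGroup E] [NormedSpace ℝ E] [FiniteDimensional ℝ E]
    [TopologicalSpace X] [T2Space X] [ChartedSpace E X]
    (A : Set X) (hA : A.Finite) (a : X) :
    ∃ U ∈ nhds a, ∀ x ∈ U, ∀ y ∈ U, x ∉ A → y ∉ A → AmbEq (insert x A) (insert y A) := by
  let e := chartAt E a
  have has : a ∈ e.source := mem_chart_source E a
  have hA' : (A \ {a}).Finite := hA.subset Set.sdiff_subset
  have hV : e.target ∩ e.symm ⁻¹' (A \ {a})ᶜ ∈ nhds (e a) := by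
    refine Filter.inter_mem (e.open_target.mem_nhds (e.map_source has)) ?_
    apply (e.continuousAt_symm (e.map_source has)).preimage_mem_nhds
    rw [e.left_inv has]
    exact hA'.isClosed.isOpen_compl.mem_nhds (by simp)
  obtain ⟨r, hr, hrV⟩ := Metric.nhds_basis_ball.mem_iff.1 hV
  have hb : e ⁻¹' (Metric.ball (e a) r) ∈ nhds a :=
    (e.continuousAt has).preimage_mem_nhds (Metric.ball_mem_nhds _ hr)
  refine ⟨e.source ∩ e ⁻¹' (Metric.ball (e a) r),
    Filter.inter_mem (e.open_source.mem_nhds has) hb, ?_⟩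
  rintro x ⟨hxs, hxb⟩ y ⟨hys, hyb⟩ hxA hyA
  have hab : e a ∈ Metric.ball (e a) r := Metric.mem_ball_self hr
  have hconv : ∀ u ∈ Metric.ball (e a) r, ∀ v ∈ Metric.ball (e a) r,
      segment ℝ u v ⊆ Metric.ball (e a) r := fun u hu v hv =>
    (convex_ball (e a) r).segment_subset hu hv
  have hT : ∀ z ∈ Metric.ball (e a) r, z ∈ e.target := fun z hz => (hrV hz).1
  have hN : ∀ z ∈ Metric.ball (e a) r, e.symm z ∈ A → z = e a ∧ a ∈ A := by
    intro z hz hzA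
    have h1 := (hrV hz).2
    have h2 : e.symm z = a := by
      by_contra h
      exact h1 ⟨hzA, h⟩
    refine ⟨?_, h2 ▸ hzA⟩
    rw [← h2, e.right_inv (hT z hz)]
  by_cases hseg : e a ∈ segment ℝ (e x) (e y) ∧ a ∈ A
  · obtain ⟨hseg, haA⟩ := hseg
    have hxa : x ≠ a := fun h => hxA (h ▸ haA)
    have hya : y ≠ a := fun h => hyA (h ▸ haA)
    have hexa : e x ≠ e a := fun h => hxa (e.injOn hxs has h)
    have heya : e y ≠ e a := fun h => hya (e.injOn hys has h)
    have hw : Wbtw ℝ (e x) (e a) (e y) := mem_segment_iff_wbtw.1 hseg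
    have n1 : e x ∉ segment ℝ (e a) (e y) := fun h =>
      hexa ((wbtw_swap_left_iff ℝ (e y)).1 ⟨hw, mem_segment_iff_wbtw.1 h⟩)
    have n2 : e y ∉ segment ℝ (e x) (e a) := fun h =>
      heya ((wbtw_swap_right_iff ℝ (e x)).1 ⟨hw, mem_segment_iff_wbtw.1 h⟩).symm
    have key : ∀ u v w : X, u ∈ e.source → v ∈ e.source → w ∈ e.source →
        e u ∈ Metric.ball (e a) r → e v ∈ Metric.ball (e a) r → e w ∉ segment ℝ (e u) (e v) →
        AmbEq (insert u (insert w (A \ {a}))) (insert v (insert w (A \ {a}))) := by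
      intro u v w hu hv hws hub hvb hwn
      refine aux_seg _ (hA'.insert w) e u v hu hv (fun z hz => hT z (hconv _ hub _ hvb hz)) ?_
      intro z hz hz'
      have hzb := hconv _ hub _ hvb hz
      rcases hz' with h | h
      · apply hwn
        rw [← h, e.right_inv (hT z hzb)]; exact hz
      · exact (hrV hzb).2 h
    have k1 := key a y x has hys hxs hab hyb n1
    have k2 := key x a y hxs has hys hxb hab n2
    have e1 : insert a (insert x (A \ {a})) = insert x A := by
      rw [Set.insert_comm, Set.insert_sdiff_singleton, Set.insert_eq_of_mem haA]
    have e2 : insert a (insert y (A \ {a})) = insert y A := by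
      rw [Set.insert_comm, Set.insert_sdiff_singleton, Set.insert_eq_of_mem haA]
    rw [e1] at k1
    rw [e2, Set.insert_comm] at k2
    exact k1.trans' k2
  · refine aux_seg A hA e x y hxs hys (fun z hz => hT z (hconv _ hxb _ hyb hz)) ?_
    intro z hz hzA
    obtain ⟨h1, h2⟩ := hN z (hconv _ hxb _ hyb hz) hzA
    exact hseg ⟨h1 ▸ hz, h2⟩

theorem aux_global {E X : Type*} [NormedAddCommGroup E] [NormedSpace ℝ E] [FiniteDimensional ℝ E]
    [TopologicalSpace X] [T2Space X] [ChartedSpace E X]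
    [ConnectedSpace X] (A : Set X) (hA : A.Finite) (x y : X) (hx : x ∉ A)
    (hy : y ∉ A) : AmbEq (insert x A) (insert y A) := by
  by_cases hxy : x = y
  · subst hxy; exact AmbEq.rfl' _
  have : Nontrivial X := ⟨x, y, hxy⟩
  have hd : Dense Aᶜ := by
    have := (dense_univ (X := X)).sdiff_finite hA
    rwa [← Set.compl_eq_univ_sdiff] at this
  let S : Set X := {w | ∀ᶠ z in nhds w, z ∉ A → AmbEq (insert x A) (insert z A)}
  have hSo : IsOpen S := isOpen_iff_mem_nhds.2 fun w hw => eventually_eventually_nhds.2 hw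
  have hSc : IsOpen Sᶜ := by
    rw [isOpen_iff_mem_nhds]
    intro w hw
    obtain ⟨U, hU, hUe⟩ := aux_nbhd (E := E) A hA w
    have hno : ∀ z ∈ U, z ∉ A → ¬ AmbEq (insert x A) (insert z A) := by
      intro z hz hzA h
      apply hw
      filter_upwards [hU] with z' hz' hzA'
      exact h.trans' (hUe z hz z' hz' hzA hzA')
    filter_upwards [eventually_mem_nhds_iff.2 hU] with v hv hvS
    obtain ⟨z, hzA, hz⟩ := mem_closure_iff_nhds.1 (hd v) _ (Filter.inter_mem hv hvS)
    exact hno z hzA.1 hz (hzA.2 hz)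
  have hS : S = Set.univ := IsClopen.eq_univ ⟨⟨hSc⟩, hSo⟩
    ⟨x, (aux_near (E := E) A hA x hx).mono fun z h _ => h⟩
  have : y ∈ S := hS ▸ Set.mem_univ y
  exact this.self_of_nhds hy

theorem aux_main {E X : Type*} [NormedAddCommGroup E] [NormedSpace ℝ E] [FiniteDimensional ℝ E]
    [TopologicalSpace X] [T2Space X] [ChartedSpace E X]
    [ConnectedSpace X] (k : ℕ) : ∀ (A B : Set X), A.Finite → B.Finite →
    A.ncard = B.ncard → (A \ B).ncard = k → AmbEq A B := by
  induction k with
  | zero =>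
    intro A B hA hB hAB h0
    have : A \ B = ∅ := (Set.ncard_eq_zero (hA.subset Set.sdiff_subset)).1 h0
    have : A = B := Set.eq_of_subset_of_ncard_le (Set.sdiff_eq_empty.1 this) hAB.ge hB
    subst this
    exact AmbEq.rfl' _
  | succ k ih =>
    intro A B hA hB hAB hk
    have hne : (A \ B).Nonempty := by
      rw [← Set.ncard_pos (hA.subset Set.sdiff_subset)]; omega
    obtain ⟨a, haA, haB⟩ := hne
    have hne' : (B \ A).Nonempty := by
      by_contra h
      rw [Set.not_nonempty_iff_eq_empty, Set.sdiff_eq_empty] at h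
      have := Set.eq_of_subset_of_ncard_le h hAB.le hA
      exact haB (this ▸ haA)
    obtain ⟨b, hbB, hbA⟩ := hne'
    have hA' : (A \ {a}).Finite := hA.subset Set.sdiff_subset
    have h1 : AmbEq (insert a (A \ {a})) (insert b (A \ {a})) :=
      aux_global (E := E) _ hA' a b (by simp) (fun h => hbA h.1)
    rw [Set.insert_sdiff_singleton, Set.insert_eq_of_mem haA] at h1
    refine h1.trans' (ih _ _ (hA'.insert b) hB ?_ ?_)
    · rw [Set.ncard_insert_of_notMem (fun h => hbA h.1) hA',
        Set.ncard_sdiff_singleton_add_one haA hA, hAB]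
    · have : insert b (A \ {a}) \ B = (A \ B) \ {a} := by
        ext z
        simp only [Set.mem_sdiff, Set.mem_insert_iff, Set.mem_singleton_iff]
        constructor
        · rintro ⟨rfl | h, h'⟩
          · exact absurd hbB h'
          · exact ⟨⟨h.1, h'⟩, h.2⟩
        · rintro ⟨⟨h, h'⟩, h''⟩
          exact ⟨Or.inr ⟨h, h''⟩, h'⟩
      rw [this]
      have := Set.ncard_sdiff_singleton_add_one (show a ∈ A \ B from ⟨haA, haB⟩)
        (hA.subset Set.sdiff_subset)
      omega

/-- The map on symmetric products induced by a homeomorphism. -/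
def symmProdMap {X : Type*} [MetricSpace X] {n : ℕ} (h : X ≃ₜ X) (P : SymmProd X n) :
    SymmProd X n :=
  ⟨NonemptyCompacts.map h h.continuous P.1, by
    rw [NonemptyCompacts.coe_map]
    exact ⟨P.2.1.image _, (Set.ncard_image_le P.2.1).trans P.2.2⟩⟩

theorem symmProdMap_cont {X : Type*} [MetricSpace X] {n : ℕ} (h : X ≃ₜ X) :
    Continuous (symmProdMap h : SymmProd X n → SymmProd X n) := by
  have h1 : Continuous (fun P : {A : NonemptyCompacts X //
      (A : Set X).Finite ∧ (A : Set X).ncard ≤ n} => NonemptyCompacts.map h h.continuous P.1) :=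
    h.continuous.nonemptyCompacts_map.comp continuous_subtype_val
  exact Continuous.subtype_mk h1 _

theorem symmProd_ext {X : Type*} [MetricSpace X] {n : ℕ} {P Q : SymmProd X n}
    (h : P.toSet = Q.toSet) : P = Q := Subtype.ext (NonemptyCompacts.ext h)

theorem symmProdMap_toSet {X : Type*} [MetricSpace X] {n : ℕ} (h : X ≃ₜ X) (P : SymmProd X n) :
    (symmProdMap h P).toSet = h '' P.toSet := NonemptyCompacts.coe_map _ _

theorem symmProd_lift {X : Type*} [MetricSpace X] {n : ℕ} (P Q : SymmProd X n)
    (h : AmbEq P.toSet Q.toSet) : ∃ H : SymmProd X n ≃ₜ SymmProd X n, H P = Q := by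
  obtain ⟨h, hh⟩ := h
  refine ⟨{ toFun := symmProdMap h, invFun := symmProdMap h.symm,
            left_inv := ?_, right_inv := ?_,
            continuous_toFun := symmProdMap_cont h,
            continuous_invFun := symmProdMap_cont h.symm }, ?_⟩
  · intro P
    apply symmProd_ext
    simp [symmProdMap_toSet, Set.image_image]
  · intro P
    apply symmProd_ext
    simp [symmProdMap_toSet, Set.image_image]
  · apply symmProd_ext
    exact (symmProdMap_toSet h P).trans hh

theorem stmt4 (m n : ℕ) (hn : 2 ≤ n) (X : Type*) [MetricSpace X]
    [ChartedSpace (EuclideanSpace ℝ (Fin m)) X] [CompactSpace X] [ConnectedSpace X] :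
    ∃ S : Set (SymmProd X n), S.Finite ∧ S.ncard ≤ n ∧
      ∀ P : SymmProd X n, ∃ Q ∈ S, ∃ h : SymmProd X n ≃ₜ SymmProd X n, h Q = P := by
  classical
  by_cases hne : Nonempty (SymmProd X n)
  swap
  · exact ⟨∅, Set.finite_empty, by simp, fun P => (hne ⟨P⟩).elim⟩
  let f : ℕ → SymmProd X n := fun k =>
    if h : ∃ P : SymmProd X n, P.toSet.ncard = k then h.choose else hne.some
  have hS : (f '' Set.Icc 1 n).Finite := (Set.finite_Icc 1 n).image f
  refine ⟨f '' Set.Icc 1 n, hS, ?_, ?_⟩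
  · refine (Set.ncard_image_le (Set.finite_Icc 1 n)).trans ?_
    rw [← Finset.coe_Icc, Set.ncard_coe_finset]; simp
  · intro P
    have hP : ∃ Q : SymmProd X n, Q.toSet.ncard = P.toSet.ncard := ⟨P, rfl⟩
    have hfP : (f P.toSet.ncard).toSet.ncard = P.toSet.ncard := by
      have : f P.toSet.ncard = hP.choose := dif_pos hP
      rw [this]; exact hP.choose_spec
    refine ⟨f P.toSet.ncard, ⟨_, ⟨?_, P.2.2⟩, rfl⟩, ?_⟩
    · exact (Set.ncard_pos P.2.1).2 P.1.nonempty
    · exact symmProd_lift _ _ (aux_main (E := EuclideanSpace ℝ (Fin m)) _ _ _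
        (f P.toSet.ncard).2.1 P.2.1 hfP rfl)
end
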